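/- arXiv:1704.00520 — 2 statements merged into one kernel-verified Lean document; each statement's English description precedes it below -/
import Mathlib

section
/- Let σ_n > 0, v₀ > 0, ε, m₀ ∈ ℝ, and let τ satisfy 0 < τ² ≤ v₀². Set v₁² = v₀² − τ², a = (ε − m₀)/√(σ_n² + v₀²), and for m₁ ∈ ℝ set c(m₁) = (ε − m₁)/√(σ_n² + v₁²). Then ∫_ℝ [Φ(c(m₁)) − Φ(c(m₁))² − 2·T(c(m₁), σ_n/√(σ_n² + 2v₁²))] · N(m₁ | m₀, τ²) dm₁ = 2·[T(a, √((σ_n² + v₀² − τ²)/(σ_n² + v₀² + τ²))) − T(a, σ_n/√(σ_n² + 2v₀²))]. -/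
open MeasureTheory Real

/-- Standard normal cumulative distribution function. -/
noncomputable def Phi (x : ℝ) : ℝ :=
  ∫ t in Set.Iic x, Real.exp (-t ^ 2 / 2) / Real.sqrt (2 * Real.pi)

/-- Gaussian probability density with mean `m` and standard deviation `v`. -/
noncomputable def gaussPdf (m v x : ℝ) : ℝ :=
  Real.exp (-(x - m) ^ 2 / (2 * v ^ 2)) / Real.sqrt (2 * Real.pi * v ^ 2)

/-- Owen's t-function. -/
noncomputable def OwenT (h a : ℝ) : ℝ :=
  (1 / (2 * Real.pi)) * ∫ x in (0:ℝ)..a, Real.exp (-h ^ 2 * (1 + x ^ 2) / 2) / (1 + x ^ 2)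

lemma integrable_exp_neg_sq_div_two :
    Integrable (fun t : ℝ => Real.exp (-t ^ 2 / 2)) := by
  refine (integrable_exp_neg_mul_sq (b := 1 / 2) (by norm_num)).congr (.of_forall fun t => ?_)
  dsimp only
  congr 1
  ring

lemma Phi_zero : Phi 0 = 1 / 2 := by
  have h1 : ∫ t in Set.Iic (0 : ℝ), Real.exp (-t ^ 2 / 2) = Real.sqrt (2 * π) / 2 := by
    have h2 := integral_comp_neg_Iic (0 : ℝ) (fun t => Real.exp (-(1 / 2) * t ^ 2))
    rw [neg_zero, integral_gaussian_Ioi] at h2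
    rw [show 2 * π = π / (1 / 2) by ring, ← h2]
    congr 1
    ext t
    congr 1
    ring
  have h3 : Real.sqrt (2 * π) ≠ 0 := by positivity
  rw [Phi, integral_div, h1]
  field_simp

lemma Phi_eq (x : ℝ) :
    Phi x = 1 / 2 + ∫ t in (0 : ℝ)..x, Real.exp (-t ^ 2 / 2) / Real.sqrt (2 * π) := by
  have h := integrable_exp_neg_sq_div_two.div_const (Real.sqrt (2 * π))
  rw [← Phi_zero, ← intervalIntegral.integral_Iic_sub_Iic h.integrableOn h.integrableOn]
  simp only [Phi]
  ring

lemma hasDerivAt_Phi (x : ℝ) :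
    HasDerivAt Phi (Real.exp (-x ^ 2 / 2) / Real.sqrt (2 * π)) x := by
  rw [funext Phi_eq]
  have hc : Continuous fun t : ℝ => Real.exp (-t ^ 2 / 2) / Real.sqrt (2 * π) := by fun_prop
  exact (hc.integral_hasStrictDerivAt 0 x).hasDerivAt.const_add _

lemma hasDerivAt_OwenT (h a : ℝ) :
    HasDerivAt (fun h => OwenT h a)
      ((1 / (2 * π)) * ∫ x in (0 : ℝ)..a, -h * Real.exp (-h ^ 2 * (1 + x ^ 2) / 2)) h := by
  refine HasDerivAt.const_mul _ ?_
  have hne (x : ℝ) : 1 + x ^ 2 ≠ 0 := by positivity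
  have hF (y : ℝ) : Continuous fun x : ℝ => Real.exp (-y ^ 2 * (1 + x ^ 2) / 2) / (1 + x ^ 2) := by
    fun_prop (disch := exact hne _)
  have hF' : Continuous fun x : ℝ => -h * Real.exp (-h ^ 2 * (1 + x ^ 2) / 2) := by fun_prop
  refine (intervalIntegral.hasDerivAt_integral_of_dominated_loc_of_deriv_le
    (F := fun h x => Real.exp (-h ^ 2 * (1 + x ^ 2) / 2) / (1 + x ^ 2))
    (F' := fun h x => -h * Real.exp (-h ^ 2 * (1 + x ^ 2) / 2))
    (bound := fun _ => |h| + 1)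
    (Metric.ball_mem_nhds h one_pos) (.of_forall fun y => (hF y).aestronglyMeasurable)
    ((hF h).intervalIntegrable _ _) hF'.aestronglyMeasurable ?_ (by simp) ?_).2
  · refine .of_forall fun x _ y hy => ?_
    rw [Metric.mem_ball, Real.dist_eq] at hy
    have h1 : |y| ≤ |h| + 1 := by linarith [abs_sub_abs_le_abs_sub y h]
    have h2 : Real.exp (-y ^ 2 * (1 + x ^ 2) / 2) ≤ 1 :=
      Real.exp_le_one_iff.2 (by nlinarith [mul_nonneg (sq_nonneg y) (sq_nonneg x), sq_nonneg y])
    rw [norm_mul, norm_neg, Real.norm_eq_abs, Real.norm_eq_abs, Real.abs_exp]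
    calc |y| * _ ≤ |y| * 1 := by gcongr
      _ ≤ _ := by linarith
  · refine .of_forall fun x _ y _ => ?_
    have h3 : HasDerivAt (fun y : ℝ => -y ^ 2 * (1 + x ^ 2) / 2) (-y * (1 + x ^ 2)) y := by
      have := (((hasDerivAt_id y).pow 2).neg.mul_const (1 + x ^ 2)).div_const 2
      exact this.congr_deriv (by simp; ring)
    refine (h3.exp.div_const (1 + x ^ 2)).congr_deriv ?_
    have := hne x
    field_simp

/-- The value of Owen's function at slope one. -/
lemma Phi_sub_sq (c : ℝ) : Phi c - Phi c ^ 2 = 2 * OwenT c 1 := by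
  have hd (x : ℝ) : HasDerivAt (fun c => Phi c - Phi c ^ 2 - 2 * OwenT c 1) 0 x := by
    have := ((hasDerivAt_Phi x).sub ((hasDerivAt_Phi x).pow 2)).sub
      ((hasDerivAt_OwenT x 1).const_mul 2)
    refine this.congr_deriv ?_
    have h1 : ∫ t in (0 : ℝ)..1, -x * Real.exp (-x ^ 2 * (1 + t ^ 2) / 2)
        = -Real.exp (-x ^ 2 / 2) * ∫ t in (0 : ℝ)..x, Real.exp (-t ^ 2 / 2) := by
      have h2 := intervalIntegral.mul_integral_comp_mul_left (a := 0) (b := 1)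
        (f := fun t => Real.exp (-t ^ 2 / 2)) x
      rw [mul_zero, mul_one] at h2
      rw [← h2, ← mul_assoc, ← intervalIntegral.integral_const_mul]
      congr 1
      ext t
      rw [show -x ^ 2 * (1 + t ^ 2) / 2 = -x ^ 2 / 2 + -(x * t) ^ 2 / 2 by ring, Real.exp_add]
      ring
    rw [h1, Phi_eq, intervalIntegral.integral_div]
    have h3 : Real.sqrt (2 * π) ≠ 0 := by positivity
    have h4 : 2 * π = Real.sqrt (2 * π) ^ 2 := (Real.sq_sqrt (by positivity)).symm
    generalize Real.sqrt (2 * π) = s at *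
    rw [h4]
    generalize (∫ t in (0 : ℝ)..x, Real.exp (-t ^ 2 / 2)) = I
    generalize Real.exp (-x ^ 2 / 2) = E
    push_cast
    field_simp
    ring
  have h0 : OwenT 0 1 = 1 / 8 := by
    simp only [OwenT]
    norm_num
    field_simp
    norm_num
  have := is_const_of_deriv_eq_zero (fun x => (hd x).differentiableAt) (fun x => (hd x).deriv) c 0
  rw [Phi_zero, h0] at this
  linarith

lemma gaussPdf_eq (m v x : ℝ) :
    gaussPdf m v x
      = (Real.sqrt (2 * π * v ^ 2))⁻¹ * Real.exp (-(1 / (2 * v ^ 2)) * (x - m) ^ 2) := by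
  rw [gaussPdf, div_eq_inv_mul]
  congr 2
  ring

lemma integrable_gaussPdf {m v : ℝ} (hv : 0 < v ^ 2) : Integrable (gaussPdf m v) := by
  rw [funext (gaussPdf_eq m v)]
  exact ((integrable_exp_neg_mul_sq (b := 1 / (2 * v ^ 2)) (by positivity)).comp_sub_right
    m).const_mul _

lemma integral_exp_mul_gaussPdf {p v : ℝ} (e m : ℝ) (hp : 0 ≤ p) (hv : 0 < v ^ 2) :
    ∫ x, Real.exp (-p * (e - x) ^ 2) * gaussPdf m v x
      = Real.exp (-p * (e - m) ^ 2 / (1 + 2 * p * v ^ 2)) / Real.sqrt (1 + 2 * p * v ^ 2) := by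
  set w := v ^ 2 with hw
  set q := p + 1 / (2 * w) with hq
  have hq0 : 0 < q := by positivity
  have h1 : 0 < 1 + 2 * p * w := by positivity
  have h2 (x : ℝ) : Real.exp (-p * (e - x) ^ 2) * gaussPdf m v x
      = (Real.sqrt (2 * π * w))⁻¹ * Real.exp (-p * (e - m) ^ 2 / (1 + 2 * p * w))
        * Real.exp (-q * (x - (p * e + m / (2 * w)) / q) ^ 2) := by
    rw [gaussPdf_eq, mul_left_comm, mul_assoc (_)⁻¹, ← Real.exp_add, ← Real.exp_add]
    congr 2
    rw [← hw, show q = (1 + 2 * p * w) / (2 * w) by rw [hq]; field_simp; ring]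
    field_simp
    ring
  simp_rw [h2]
  rw [integral_const_mul, integral_sub_right_eq_self (fun x => Real.exp (-q * x ^ 2)),
    integral_gaussian]
  have h3 : Real.sqrt (π / q) = Real.sqrt (2 * π * w) / Real.sqrt (1 + 2 * p * w) := by
    rw [← Real.sqrt_div (by positivity)]
    congr 1
    rw [show q = (1 + 2 * p * w) / (2 * w) by rw [hq]; field_simp; ring]
    field_simp
  have h4 : Real.sqrt (2 * π * w) ≠ 0 := by positivity
  rw [h3]
  field_simp

/-- The substitution `y = √S x / √(S + w + w x²)` in Owen's integral. -/
lemma OwenT_subst {S w : ℝ} (hS : 0 < S) (hw : 0 < w) (d k : ℝ) :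
    OwenT (d / Real.sqrt (S + w)) (Real.sqrt S * k / Real.sqrt (S + w + w * k ^ 2))
      = (1 / (2 * π)) * ∫ x in (0 : ℝ)..k,
          Real.exp (-d ^ 2 * (1 + x ^ 2) / (2 * (S + w + w * x ^ 2)))
            * (Real.sqrt S / Real.sqrt (S + w + w * x ^ 2)) / (1 + x ^ 2) := by
  rw [OwenT]
  congr 1
  have hpos (x : ℝ) : 0 < S + w + w * x ^ 2 := by positivity
  have hR (x : ℝ) : HasDerivAt (fun x : ℝ => Real.sqrt (S + w + w * x ^ 2))
      (w * x / Real.sqrt (S + w + w * x ^ 2)) x := by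
    have := ((((hasDerivAt_id x).pow 2).const_mul w).const_add (S + w)).sqrt (hpos x).ne'
    refine this.congr_deriv ?_
    simp only [id, Nat.cast_ofNat, Pi.pow_apply]
    field_simp
    norm_num
  have hf (x : ℝ) : HasDerivAt (fun x : ℝ => Real.sqrt S * x / Real.sqrt (S + w + w * x ^ 2))
      (Real.sqrt S * (S + w) / Real.sqrt (S + w + w * x ^ 2) ^ 3) x := by
    have hs : Real.sqrt (S + w + w * x ^ 2) ≠ 0 := by have := hpos x; positivity
    have := ((hasDerivAt_id x).const_mul (Real.sqrt S)).div (hR x) hs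
    refine this.congr_deriv ?_
    have hsq := Real.sq_sqrt (hpos x).le
    simp only [id]
    generalize Real.sqrt (S + w + w * x ^ 2) = r at *
    field_simp
    rw [hsq]
    ring
  have hc : Continuous fun x : ℝ =>
      Real.sqrt S * (S + w) / Real.sqrt (S + w + w * x ^ 2) ^ 3 := by
    fun_prop (disch := intro x; have := hpos x; positivity)
  have hg : Continuous fun y : ℝ =>
      Real.exp (-(d / Real.sqrt (S + w)) ^ 2 * (1 + y ^ 2) / 2) / (1 + y ^ 2) := by
    fun_prop (disch := intro x; positivity)
  have key := intervalIntegral.integral_comp_mul_deriv (a := 0) (b := k) (fun x _ => hf x)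
    hc.continuousOn hg
  rw [mul_zero, zero_div] at key
  rw [← key]
  congr 1
  ext x
  have hsq := Real.sq_sqrt (hpos x).le
  have h1 : 1 + (Real.sqrt S * x / Real.sqrt (S + w + w * x ^ 2)) ^ 2
      = (S + w) * (1 + x ^ 2) / (S + w + w * x ^ 2) := by
    have := hpos x
    rw [div_pow, mul_pow, Real.sq_sqrt hS.le, hsq]
    field_simp
    ring
  have h2 : -(d / Real.sqrt (S + w)) ^ 2 * ((S + w) * (1 + x ^ 2) / (S + w + w * x ^ 2)) / 2
      = -d ^ 2 * (1 + x ^ 2) / (2 * (S + w + w * x ^ 2)) := by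
    have := hpos x
    rw [div_pow, Real.sq_sqrt (by positivity)]
    field_simp
  simp only [Function.comp]
  rw [h1, h2]
  generalize Real.exp _ = E
  have hs : 0 < Real.sqrt (S + w + w * x ^ 2) := Real.sqrt_pos.2 (hpos x)
  have h3 : (S + w) * (1 + x ^ 2) / (S + w + w * x ^ 2)
      = (S + w) * (1 + x ^ 2) / Real.sqrt (S + w + w * x ^ 2) ^ 2 := by rw [hsq]
  rw [h3]
  generalize Real.sqrt (S + w + w * x ^ 2) = r at *
  field_simp

lemma integrable_owen_kernel {v : ℝ} (s e m k : ℝ) (hv : 0 < v ^ 2) :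
    Integrable (fun z : ℝ × ℝ =>
      Real.exp (-((e - z.2) / s) ^ 2 * (1 + z.1 ^ 2) / 2) / (1 + z.1 ^ 2) * gaussPdf m v z.2)
      ((volume.restrict (Set.Ioc 0 k)).prod volume) := by
  have hg := (integrable_gaussPdf (m := m) hv).comp_snd (volume.restrict (Set.Ioc (0 : ℝ) k))
  refine hg.bdd_mul (c := 1) ?_ (.of_forall fun z => ?_)
  · have : Continuous fun z : ℝ × ℝ =>
        Real.exp (-((e - z.2) / s) ^ 2 * (1 + z.1 ^ 2) / 2) / (1 + z.1 ^ 2) := by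
      fun_prop (disch := intro x; positivity)
    exact this.aestronglyMeasurable
  · rw [Real.norm_of_nonneg (by positivity), div_le_one (by positivity)]
    have h1 : Real.exp (-((e - z.2) / s) ^ 2 * (1 + z.1 ^ 2) / 2) ≤ 1 :=
      Real.exp_le_one_iff.2 (by
        have : 0 ≤ ((e - z.2) / s) ^ 2 * (1 + z.1 ^ 2) := by positivity
        linarith)
    nlinarith [sq_nonneg z.1]

lemma OwenT_mul_gaussPdf (s e m v x : ℝ) {k : ℝ} (hk : 0 ≤ k) :
    OwenT ((e - x) / s) k * gaussPdf m v x
      = (1 / (2 * π)) * ∫ t in Set.Ioc 0 k,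
          Real.exp (-((e - x) / s) ^ 2 * (1 + t ^ 2) / 2) / (1 + t ^ 2) * gaussPdf m v x := by
  rw [OwenT, intervalIntegral.integral_of_le hk, integral_mul_const, mul_assoc]

lemma integrable_OwenT_mul_gaussPdf {v k : ℝ} (s e m : ℝ) (hv : 0 < v ^ 2) (hk : 0 ≤ k) :
    Integrable fun x => OwenT ((e - x) / s) k * gaussPdf m v x := by
  simp_rw [OwenT_mul_gaussPdf s e m v _ hk]
  exact (integrable_owen_kernel s e m k hv).integral_prod_right.const_mul _

/-- Gaussian smoothing of Owen's function gives Owen's function again. -/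
lemma integral_OwenT_mul_gaussPdf {S v k : ℝ} (e m : ℝ) (hS : 0 < S) (hv : 0 < v ^ 2)
    (hk : 0 ≤ k) :
    ∫ x, OwenT ((e - x) / Real.sqrt S) k * gaussPdf m v x
      = OwenT ((e - m) / Real.sqrt (S + v ^ 2))
          (Real.sqrt S * k / Real.sqrt (S + v ^ 2 + v ^ 2 * k ^ 2)) := by
  simp_rw [OwenT_mul_gaussPdf (Real.sqrt S) e m v _ hk]
  rw [OwenT_subst hS hv, integral_const_mul, intervalIntegral.integral_of_le hk,
    ← integral_integral_swap (integrable_owen_kernel (Real.sqrt S) e m k hv)]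
  congr 2
  ext t
  have h1 (x : ℝ) : Real.exp (-((e - x) / Real.sqrt S) ^ 2 * (1 + t ^ 2) / 2) / (1 + t ^ 2)
        * gaussPdf m v x
      = Real.exp (-((1 + t ^ 2) / (2 * S)) * (e - x) ^ 2) * gaussPdf m v x / (1 + t ^ 2) := by
    rw [div_pow, Real.sq_sqrt hS.le, div_mul_eq_mul_div]
    congr 3
    field_simp
  simp_rw [h1]
  rw [integral_div, integral_exp_mul_gaussPdf e m (by positivity) hv]
  have h2 : 1 + 2 * ((1 + t ^ 2) / (2 * S)) * v ^ 2 = (S + v ^ 2 + v ^ 2 * t ^ 2) / S := by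
    field_simp
    ring
  have h3 : 0 < S + v ^ 2 + v ^ 2 * t ^ 2 := by positivity
  rw [h2, Real.sqrt_div h3.le]
  congr 1
  rw [div_eq_mul_inv, inv_div]
  congr 2
  field_simp

theorem stmt_6 (σn v₀ ε m₀ τ : ℝ) (hσ : 0 < σn) (hv : 0 < v₀)
    (hτ : 0 < τ ^ 2) (hτv : τ ^ 2 ≤ v₀ ^ 2) :
    ∫ m₁ : ℝ,
        (Phi ((ε - m₁) / Real.sqrt (σn ^ 2 + (v₀ ^ 2 - τ ^ 2)))
            - Phi ((ε - m₁) / Real.sqrt (σn ^ 2 + (v₀ ^ 2 - τ ^ 2))) ^ 2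
            - 2 * OwenT ((ε - m₁) / Real.sqrt (σn ^ 2 + (v₀ ^ 2 - τ ^ 2)))
                (σn / Real.sqrt (σn ^ 2 + 2 * (v₀ ^ 2 - τ ^ 2))))
          * gaussPdf m₀ τ m₁
      = 2 *
        (OwenT ((ε - m₀) / Real.sqrt (σn ^ 2 + v₀ ^ 2))
            (Real.sqrt ((σn ^ 2 + v₀ ^ 2 - τ ^ 2) / (σn ^ 2 + v₀ ^ 2 + τ ^ 2)))
          - OwenT ((ε - m₀) / Real.sqrt (σn ^ 2 + v₀ ^ 2))
              (σn / Real.sqrt (σn ^ 2 + 2 * v₀ ^ 2))) := by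
  have hS : 0 < σn ^ 2 + (v₀ ^ 2 - τ ^ 2) := by
    have := pow_pos hσ 2
    linarith
  have hk : 0 ≤ σn / Real.sqrt (σn ^ 2 + 2 * (v₀ ^ 2 - τ ^ 2)) := by positivity
  simp_rw [Phi_sub_sq, ← mul_sub, mul_assoc, sub_mul]
  rw [integral_const_mul,
    integral_sub (integrable_OwenT_mul_gaussPdf _ _ _ hτ zero_le_one)
      (integrable_OwenT_mul_gaussPdf _ _ _ hτ hk),
    integral_OwenT_mul_gaussPdf _ _ hS hτ zero_le_one, integral_OwenT_mul_gaussPdf _ _ hS hτ hk]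
  have h1 : σn ^ 2 + (v₀ ^ 2 - τ ^ 2) + τ ^ 2 = σn ^ 2 + v₀ ^ 2 := by ring
  rw [h1]
  congr 3
  · rw [mul_one, ← Real.sqrt_div hS.le]
    congr 2 <;> ring
  · have hD : 0 < σn ^ 2 + 2 * (v₀ ^ 2 - τ ^ 2) := by linarith [pow_pos hσ 2]
    have h2 : σn ^ 2 + v₀ ^ 2
          + τ ^ 2 * (σn / Real.sqrt (σn ^ 2 + 2 * (v₀ ^ 2 - τ ^ 2))) ^ 2
        = (σn ^ 2 + (v₀ ^ 2 - τ ^ 2)) * (σn ^ 2 + 2 * v₀ ^ 2)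
          / (σn ^ 2 + 2 * (v₀ ^ 2 - τ ^ 2)) := by
      rw [div_pow, Real.sq_sqrt hD.le]
      field_simp
      ring
    rw [h2, Real.sqrt_div (by positivity), Real.sqrt_mul hS.le]
    have h3 := Real.sqrt_pos.2 hS
    have h4 := Real.sqrt_pos.2 hD
    have h5 : 0 < Real.sqrt (σn ^ 2 + 2 * v₀ ^ 2) := by positivity
    generalize Real.sqrt (σn ^ 2 + 2 * (v₀ ^ 2 - τ ^ 2)) = r at *
    field_simp
end

section
/- Let p, t ≥ 1 be integers, σ_n > 0, ε ∈ ℝ, k : ℝ^p × ℝ^p → ℝ a symmetric measurable kernel, θ₁, …, θ_t, θ* ∈ ℝ^p, and Δ ∈ ℝ^t. Let K be the t×t matrix with entries K_{ij} = k(θ_i, θ_j) + σ_n²·1_{i=j}, and assume K is invertible. For θ ∈ ℝ^p define m(θ) = k(θ, θ_{1:t})ᵀ K^{-1} Δ, v²(θ) = k(θ, θ) − k(θ, θ_{1:t})ᵀ K^{-1} k(θ_{1:t}, θ), cov(θ) = k(θ, θ*) − k(θ, θ_{1:t})ᵀ K^{-1} k(θ_{1:t}, θ*), τ²(θ) = cov(θ)²/(σ_n²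 + v²(θ*)), v₁²(θ) = v²(θ) − τ²(θ), and for Δ* ∈ ℝ define m₁(θ, Δ*) = m(θ) + cov(θ)·(σ_n² + v²(θ*))^{-1}·(Δ* − m(θ*)). Assume that the functions m, v², cov are measurable, that v²(θ) ≥ τ²(θ) ≥ 0 and v²(θ) ≥ 0 for all θ, and that v²(θ*) ≥ 0. Let π : ℝ^p → ℝ be a measurable probability density with π(θ) ≤ C for all θ and some constant C. Then, with c(θ, Δ*) = (ε − m₁(θ, Δ*))/√(σ_n² + v₁²(θ)) and a(θ) = (ε − m(θ))/√(σ_n² + v²(θ)), one has ∫_ℝ (∫_{ℝ^p} π(θ)² · [Φ(c(θ,Δ*)) − Φ(c(θ,Δ*))² − 2·T(c(θ,Δ*), σ_n/√(σ_n² + 2v₁²(θ)))] dθ) · N(Δ* | m(θ*), σ_n² + v²(θ*)) dΔ* = 2·∫_{ℝ^p} π(θ)² · [T(a(θ), √((σ_n² + v²(θ) − τ²(θ))/(σ_n² + v²(θ) + τ²(θ)))) − T(a(θ), σ_n/√(σ_n² + 2v²(θ)))] dθ. -/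
open MeasureTheory Real

open Matrix

open ProbabilityTheory

/-- `Φ` as a primitive based at `0`. -/
theorem Phi_eq_half_add (h : ℝ) :
    Phi h = 1 / 2 + (∫ u in (0:ℝ)..h, exp (-u ^ 2 / 2)) / √(2 * π) := by
  have hInt : Integrable fun u : ℝ => exp (-u ^ 2 / 2) := by
    convert integrable_exp_neg_mul_sq (b := 1 / 2) (by norm_num) using 3
    ring
  have h0 : ∫ u in Set.Iic (0:ℝ), exp (-u ^ 2 / 2) = √(2 * π) / 2 := by
    have h1 := integral_comp_neg_Iic (0:ℝ) fun u => exp (-u ^ 2 / 2)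
    have h2 := integral_gaussian_Ioi (1 / 2)
    simp only [neg_sq, neg_zero] at h1
    rw [h1, show 2 * π = π / (1 / 2) by ring, ← h2]
    congr 1 with u
    congr 1
    ring
  have hpos : 0 < √(2 * π) := by positivity
  rw [Phi, integral_div, ← intervalIntegral.integral_Iic_sub_Iic hInt.integrableOn
    hInt.integrableOn, h0]
  field_simp
  ring

theorem hasDerivAt_integral_exp_neg_sq_div (h : ℝ) :
    HasDerivAt (fun h : ℝ => ∫ x in (0:ℝ)..1, exp (-h ^ 2 * (1 + x ^ 2) / 2) / (1 + x ^ 2))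
      (-(exp (-h ^ 2 / 2) * ∫ u in (0:ℝ)..h, exp (-u ^ 2 / 2))) h := by
  have hpos : ∀ x : ℝ, 0 < 1 + x ^ 2 := fun x => by positivity
  have hcont : ∀ y : ℝ, Continuous fun x : ℝ => exp (-y ^ 2 * (1 + x ^ 2) / 2) / (1 + x ^ 2) :=
    fun y => Continuous.div (by fun_prop) (by fun_prop) fun x => (hpos x).ne'
  have key := intervalIntegral.hasDerivAt_integral_of_dominated_loc_of_deriv_le (μ := volume)
    (a := 0) (b := 1) (x₀ := h) (s := Metric.ball h 1) (bound := fun _ => |h| + 1)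
    (F := fun (h x : ℝ) => exp (-h ^ 2 * (1 + x ^ 2) / 2) / (1 + x ^ 2))
    (F' := fun (h x : ℝ) => -(exp (-h ^ 2 * (1 + x ^ 2) / 2) * h))
    (Metric.ball_mem_nhds h one_pos)
    (.of_forall fun y => (hcont y).aestronglyMeasurable)
    ((hcont h).intervalIntegrable 0 1)
    (Continuous.aestronglyMeasurable (by fun_prop))
    (ae_of_all _ fun x _ y hy => ?_) (by simp) (ae_of_all _ fun x _ y _ => ?_)
  · refine key.2.congr_deriv ?_
    have hsub := intervalIntegral.mul_integral_comp_mul_left (a := 0) (b := 1)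
      (f := fun u : ℝ => exp (-u ^ 2 / 2)) h
    simp only [mul_zero, mul_one] at hsub
    rw [← hsub, intervalIntegral.integral_neg, intervalIntegral.integral_mul_const,
      mul_left_comm, mul_comm h, ← intervalIntegral.integral_const_mul]
    congr 2
    congr 1 with x
    rw [← exp_add]
    congr 1
    ring
  · have h1 : |y| ≤ |h| + 1 := by
      have h2 := abs_sub_abs_le_abs_sub y h
      rw [Metric.mem_ball, dist_eq] at hy
      linarith
    rw [norm_neg, norm_mul, norm_eq_abs, norm_eq_abs, abs_of_pos (exp_pos _)]
    have h2 : exp (-y ^ 2 * (1 + x ^ 2) / 2) ≤ 1 :=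
      exp_le_one_iff.2 (by nlinarith [mul_nonneg (sq_nonneg y) (hpos x).le])
    nlinarith [abs_nonneg y]
  · have h1 : HasDerivAt (fun z : ℝ => -z ^ 2 * (1 + x ^ 2) / 2) (-(2 * y) * (1 + x ^ 2) / 2) y := by
      simpa using (((hasDerivAt_pow 2 y).neg).mul_const (1 + x ^ 2)).div_const 2
    refine (h1.exp.div_const (1 + x ^ 2)).congr_deriv ?_
    field_simp [(hpos x).ne']

/-- The derivative of the left-hand side in `h` vanishes; at `h = 0` its value is `2 arctan 1`. -/
theorem integral_exp_sq_add_two_mul_integral (h : ℝ) :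
    (∫ u in (0:ℝ)..h, exp (-u ^ 2 / 2)) ^ 2
      + 2 * ∫ x in (0:ℝ)..1, exp (-h ^ 2 * (1 + x ^ 2) / 2) / (1 + x ^ 2) = π / 2 := by
  have hJ : ∀ y : ℝ, HasDerivAt (fun y => ∫ u in (0:ℝ)..y, exp (-u ^ 2 / 2))
      (exp (-y ^ 2 / 2)) y := fun y =>
    (Continuous.integral_hasStrictDerivAt (by fun_prop) 0 y).hasDerivAt
  have hd : ∀ y, HasDerivAt (fun y => (∫ u in (0:ℝ)..y, exp (-u ^ 2 / 2)) ^ 2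
      + 2 * ∫ x in (0:ℝ)..1, exp (-y ^ 2 * (1 + x ^ 2) / 2) / (1 + x ^ 2)) 0 y := fun y => by
    refine (((hJ y).pow 2).add
      ((hasDerivAt_integral_exp_neg_sq_div y).const_mul 2)).congr_deriv ?_
    norm_num
    ring
  have hc := is_const_of_deriv_eq_zero (fun y => (hd y).differentiableAt)
    (fun y => (hd y).deriv) h 0
  rw [hc]
  simp
  ring

/-- `Φ(h)² = Φ(h) - 2 T(h, 1)`. -/
theorem Phi_sub_Phi_sq (h : ℝ) : Phi h - Phi h ^ 2 = 2 * OwenT h 1 := by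
  have h1 := integral_exp_sq_add_two_mul_integral h
  have h2 : √(2 * π) ^ 2 = 2 * π := sq_sqrt (by positivity)
  rw [Phi_eq_half_add, OwenT]
  generalize (∫ u in (0:ℝ)..h, exp (-u ^ 2 / 2)) = J at *
  generalize (∫ x in (0:ℝ)..1, exp (-h ^ 2 * (1 + x ^ 2) / 2) / (1 + x ^ 2)) = G at *
  have h3 : (J / √(2 * π)) ^ 2 = J ^ 2 / (2 * π) := by rw [div_pow, h2]
  have h4 : G = (π / 2 - J ^ 2) / 2 := by linarith
  have : (1 / 2 + J / √(2 * π)) - (1 / 2 + J / √(2 * π)) ^ 2 = 1 / 4 - (J / √(2 * π)) ^ 2 := by ring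
  rw [this, h3, h4]
  field_simp
  ring

theorem continuous_OwenT : Continuous fun q : ℝ × ℝ => OwenT q.1 q.2 := by
  have h := intervalIntegral.continuous_parametric_primitive_of_continuous (μ := volume) (a₀ := 0)
    (f := fun (h x : ℝ) => exp (-h ^ 2 * (1 + x ^ 2) / 2) / (1 + x ^ 2))
    (Continuous.div (by fun_prop) (by fun_prop) fun q => by positivity)
  exact continuous_const.mul h

theorem abs_OwenT_le (h a : ℝ) : |OwenT h a| ≤ |a| := by
  have h1 : ‖∫ x in (0:ℝ)..a, exp (-h ^ 2 * (1 + x ^ 2) / 2) / (1 + x ^ 2)‖ ≤ 1 * |a - 0| := by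
    refine intervalIntegral.norm_integral_le_of_norm_le_const fun x _ => ?_
    have hx : 0 ≤ x ^ 2 := sq_nonneg x
    rw [norm_of_nonneg (by positivity), div_le_one (by positivity)]
    have h2 : exp (-h ^ 2 * (1 + x ^ 2) / 2) ≤ 1 :=
      exp_le_one_iff.2 (by nlinarith [mul_nonneg (sq_nonneg h) (by linarith : 0 ≤ 1 + x ^ 2)])
    linarith
  have h2 : |1 / (2 * π)| ≤ 1 := by
    rw [abs_of_pos (by positivity), div_le_one (by positivity)]
    linarith [two_le_pi]
  rw [OwenT, abs_mul]
  rw [sub_zero, one_mul, norm_eq_abs] at h1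
  exact (mul_le_mul h2 h1 (abs_nonneg _) zero_le_one).trans_eq (one_mul _)

theorem integral_exp_neg_mul_sq_gaussianReal {b : ℝ} (hb : 0 ≤ b) (μ q : ℝ) :
    ∫ z, exp (-(b * (μ + q * z) ^ 2 / 2)) ∂(gaussianReal 0 1)
      = (√(1 + b * q ^ 2))⁻¹ * exp (-(b * μ ^ 2 / (2 * (1 + b * q ^ 2)))) := by
  have hD : 0 < 1 + b * q ^ 2 := by positivity
  rw [integral_gaussianReal_eq_integral_smul one_ne_zero]
  have h1 : ∀ z : ℝ, gaussianPDFReal 0 1 z • exp (-(b * (μ + q * z) ^ 2 / 2))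
      = ((√(2 * π))⁻¹ * exp (-(b * μ ^ 2 / (2 * (1 + b * q ^ 2))))) *
        exp (-((1 + b * q ^ 2) / 2) * (z + b * μ * q / (1 + b * q ^ 2)) ^ 2) := fun z => by
    rw [gaussianPDFReal, smul_eq_mul, mul_assoc, mul_assoc (√(2 * π))⁻¹,
      ← exp_add, ← exp_add]
    simp only [NNReal.coe_one, mul_one, sub_zero]
    congr 2
    field_simp
    ring
  simp_rw [h1]
  rw [integral_const_mul,
    integral_add_right_eq_self fun z : ℝ => exp (-((1 + b * q ^ 2) / 2) * z ^ 2),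
    integral_gaussian, show π / ((1 + b * q ^ 2) / 2) = 2 * π / (1 + b * q ^ 2) by field_simp,
    sqrt_div (by positivity)]
  field_simp

/-- Gaussian average of Owen's function in its first argument; after integrating out `z`, the
remaining integral is transformed by `y = x / √(1 + q² + q² x²)`. -/
theorem integral_OwenT_gaussianReal (μ q r : ℝ) :
    ∫ z, OwenT (μ + q * z) r ∂(gaussianReal 0 1)
      = OwenT (μ / √(1 + q ^ 2)) (r / √(1 + q ^ 2 + q ^ 2 * r ^ 2)) := by
  have hx : ∀ x : ℝ, 0 < 1 + x ^ 2 := fun x => by positivity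
  have hD : ∀ x : ℝ, 0 < 1 + q ^ 2 + q ^ 2 * x ^ 2 := fun x => by positivity
  simp only [OwenT]
  rw [integral_const_mul, ← intervalIntegral_integral_swap]
  · congr 1
    have hg : Continuous fun y : ℝ =>
        exp (-(μ / √(1 + q ^ 2)) ^ 2 * (1 + y ^ 2) / 2) / (1 + y ^ 2) :=
      Continuous.div (by fun_prop) (by fun_prop) fun y => (hx y).ne'
    have hderiv : ∀ x : ℝ, HasDerivAt (fun x => x / √(1 + q ^ 2 + q ^ 2 * x ^ 2))
        ((1 + q ^ 2) / ((1 + q ^ 2 + q ^ 2 * x ^ 2) * √(1 + q ^ 2 + q ^ 2 * x ^ 2))) x := fun x => by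
      have h1 : HasDerivAt (fun x : ℝ => 1 + q ^ 2 + q ^ 2 * x ^ 2) (q ^ 2 * (2 * x)) x := by
        simpa using ((hasDerivAt_pow 2 x).const_mul (q ^ 2)).const_add (1 + q ^ 2)
      have hs : 0 < √(1 + q ^ 2 + q ^ 2 * x ^ 2) := sqrt_pos.2 (hD x)
      have hs2 : √(1 + q ^ 2 + q ^ 2 * x ^ 2) ^ 2 = 1 + q ^ 2 + q ^ 2 * x ^ 2 := sq_sqrt (hD x).le
      refine ((hasDerivAt_id' x).div (h1.sqrt (hD x).ne') hs.ne').congr_deriv ?_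
      have := hD x
      rw [hs2]
      field_simp
      rw [hs2]
      ring
    have hsub := intervalIntegral.integral_comp_mul_deriv (a := 0) (b := r)
      (fun x _ => hderiv x)
      (Continuous.continuousOn (Continuous.div (by fun_prop) (by fun_prop) fun x =>
        (mul_pos (hD x) (sqrt_pos.2 (hD x))).ne')) hg
    rw [zero_div] at hsub
    rw [← hsub]
    congr 1 with x
    have h1 : ∀ z : ℝ, exp (-(μ + q * z) ^ 2 * (1 + x ^ 2) / 2) / (1 + x ^ 2)
        = (1 + x ^ 2)⁻¹ * exp (-((1 + x ^ 2) * (μ + q * z) ^ 2 / 2)) := fun z => by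
      rw [div_eq_inv_mul]
      congr 2
      ring
    simp_rw [h1]
    rw [integral_const_mul, integral_exp_neg_mul_sq_gaussianReal (hx x).le]
    have hs : 0 < √(1 + q ^ 2 + q ^ 2 * x ^ 2) := sqrt_pos.2 (hD x)
    have hs2 : √(1 + q ^ 2 + q ^ 2 * x ^ 2) ^ 2 = 1 + q ^ 2 + q ^ 2 * x ^ 2 := sq_sqrt (hD x).le
    have hy : 1 + (x / √(1 + q ^ 2 + q ^ 2 * x ^ 2)) ^ 2
        = (1 + x ^ 2) * (1 + q ^ 2) / (1 + q ^ 2 + q ^ 2 * x ^ 2) := by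
      rw [div_pow, hs2]
      have := hD x
      field_simp
      ring
    simp only [Function.comp]
    rw [hy, div_pow, sq_sqrt (by positivity : 0 ≤ 1 + q ^ 2),
      show 1 + (1 + x ^ 2) * q ^ 2 = 1 + q ^ 2 + q ^ 2 * x ^ 2 by ring]
    have hE : -(μ ^ 2 / (1 + q ^ 2)) * ((1 + x ^ 2) * (1 + q ^ 2) / (1 + q ^ 2 + q ^ 2 * x ^ 2)) / 2
        = -((1 + x ^ 2) * μ ^ 2 / (2 * (1 + q ^ 2 + q ^ 2 * x ^ 2))) := by
      have := hD x
      field_simp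
    rw [hE]
    have := hD x
    have := hx x
    field_simp
  · have : IsFiniteMeasure (volume.restrict (Set.uIoc 0 r)) := ⟨by simp [Set.uIoc]⟩
    refine Integrable.of_bound (C := 1) (Continuous.aestronglyMeasurable ?_) (ae_of_all _ ?_)
    · exact Continuous.div (by fun_prop) (by fun_prop) fun q => (hx q.1).ne'
    · rintro ⟨x, z⟩
      simp only [Function.uncurry]
      have := hx x
      rw [norm_of_nonneg (by positivity), div_le_one (by positivity)]
      have h2 : exp (-(μ + q * z) ^ 2 * (1 + x ^ 2) / 2) ≤ 1 :=
        exp_le_one_iff.2 (by nlinarith [mul_nonneg (sq_nonneg (μ + q * z)) (hx x).le])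
      nlinarith [sq_nonneg x]

/-- Integration against `gaussPdf μ w` expressed through a standard normal variable. -/
theorem integral_mul_gaussPdf (f : ℝ → ℝ) (μ : ℝ) {w : ℝ} (hw : 0 < w) :
    ∫ x, f x * gaussPdf μ w x = ∫ z, f (μ + w * z) ∂(gaussianReal 0 1) := by
  rw [integral_gaussianReal_eq_integral_smul one_ne_zero]
  have h1 : ∀ z : ℝ, gaussianPDFReal 0 1 z • f (μ + w * z)
      = w * (f (w * z + μ) * gaussPdf μ w (w * z + μ)) := fun z => by
    rw [gaussianPDFReal, gaussPdf, sqrt_mul (by positivity) (w ^ 2), sqrt_sq hw.le, smul_eq_mul,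
      show -(w * z + μ - μ) ^ 2 / (2 * w ^ 2) = -(z - 0) ^ 2 / (2 * ((1 : NNReal) : ℝ)) by
        rw [NNReal.coe_one]; field_simp; ring, NNReal.coe_one, mul_one, add_comm μ]
    field_simp
  simp_rw [h1]
  rw [integral_const_mul,
    Measure.integral_comp_mul_left (fun y => f (y + μ) * gaussPdf μ w (y + μ)) w,
    integral_add_right_eq_self fun y => f y * gaussPdf μ w y, abs_of_pos (inv_pos.2 hw),
    smul_eq_mul, mul_inv_cancel_left₀ hw.ne']

theorem stmt_7 (p t : ℕ) (hp : 1 ≤ p) (ht : 1 ≤ t) (σn ε C : ℝ) (hσ : 0 < σn)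
    (k : (Fin p → ℝ) → (Fin p → ℝ) → ℝ)
    (hksymm : ∀ x y, k x y = k y x)
    (hkmeas : Measurable fun q : (Fin p → ℝ) × (Fin p → ℝ) => k q.1 q.2)
    (θs : Fin t → (Fin p → ℝ)) (θstar : Fin p → ℝ) (Δ : Fin t → ℝ)
    (K : Matrix (Fin t) (Fin t) ℝ)
    (hK : K = Matrix.of fun i j => k (θs i) (θs j) + if i = j then σn ^ 2 else 0)
    (hKinv : IsUnit K.det)
    (m v2 covf : (Fin p → ℝ) → ℝ)
    (hm : m = fun θ => (fun i => k θ (θs i)) ⬝ᵥ (K⁻¹ *ᵥ Δ))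
    (hv2 : v2 = fun θ => k θ θ - (fun i => k θ (θs i)) ⬝ᵥ (K⁻¹ *ᵥ fun i => k (θs i) θ))
    (hcov : covf = fun θ =>
      k θ θstar - (fun i => k θ (θs i)) ⬝ᵥ (K⁻¹ *ᵥ fun i => k (θs i) θstar))
    (τ2 v12 : (Fin p → ℝ) → ℝ)
    (hτ2 : τ2 = fun θ => covf θ ^ 2 / (σn ^ 2 + v2 θstar))
    (hv12 : v12 = fun θ => v2 θ - τ2 θ)
    (m1 : (Fin p → ℝ) → ℝ → ℝ)
    (hm1 : m1 = fun θ Δstar => m θ + covf θ * (σn ^ 2 + v2 θstar)⁻¹ * (Δstar - m θstar))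
    (hmmeas : Measurable m) (hv2meas : Measurable v2) (hcovmeas : Measurable covf)
    (hτnn : ∀ θ, 0 ≤ τ2 θ) (hτv : ∀ θ, τ2 θ ≤ v2 θ) (hv2nn : ∀ θ, 0 ≤ v2 θ)
    (hvstar : 0 ≤ v2 θstar)
    (prior : (Fin p → ℝ) → ℝ) (hπmeas : Measurable prior) (hπnn : ∀ θ, 0 ≤ prior θ)
    (hπint : ∫ θ, prior θ = 1) (hπbdd : ∀ θ, prior θ ≤ C) :
    ∫ Δstar : ℝ,
        (∫ θ, prior θ ^ 2 *
            (Phi ((ε - m1 θ Δstar) / Real.sqrt (σn ^ 2 + v12 θ))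
              - Phi ((ε - m1 θ Δstar) / Real.sqrt (σn ^ 2 + v12 θ)) ^ 2
              - 2 * OwenT ((ε - m1 θ Δstar) / Real.sqrt (σn ^ 2 + v12 θ))
                  (σn / Real.sqrt (σn ^ 2 + 2 * v12 θ))))
          * gaussPdf (m θstar) (Real.sqrt (σn ^ 2 + v2 θstar)) Δstar
      = 2 * ∫ θ, prior θ ^ 2 *
          (OwenT ((ε - m θ) / Real.sqrt (σn ^ 2 + v2 θ))
              (Real.sqrt ((σn ^ 2 + v2 θ - τ2 θ) / (σn ^ 2 + v2 θ + τ2 θ)))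
            - OwenT ((ε - m θ) / Real.sqrt (σn ^ 2 + v2 θ))
                (σn / Real.sqrt (σn ^ 2 + 2 * v2 θ))) := by
  have hw2 : 0 < σn ^ 2 + v2 θstar := by positivity
  have hw : 0 < √(σn ^ 2 + v2 θstar) := sqrt_pos.2 hw2
  have hv12nn : ∀ θ, 0 ≤ v12 θ := fun θ => by simpa [hv12] using hτv θ
  have hτmeas : Measurable τ2 := by
    rw [hτ2]
    exact (hcovmeas.pow_const 2).div_const _
  have hv12meas : Measurable v12 := by
    rw [hv12]
    exact hv2meas.sub hτmeas
  have hm1meas : Measurable fun q : (Fin p → ℝ) × ℝ =>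
      m1 q.1 (m θstar + √(σn ^ 2 + v2 θstar) * q.2) := by
    rw [hm1]
    fun_prop
  simp_rw [Phi_sub_Phi_sq]
  rw [integral_mul_gaussPdf _ _ hw, integral_integral_swap, ← integral_const_mul]
  · congr 1 with θ
    have hS2 : 0 < σn ^ 2 + v12 θ := by have := hv12nn θ; positivity
    have hR : 0 < σn ^ 2 + 2 * v12 θ := by have := hv12nn θ; positivity
    have hτ : 0 ≤ τ2 θ := hτnn θ
    have hv2' : v2 θ = v12 θ + τ2 θ := by simp [hv12]
    have hq2 : (-covf θ / (√(σn ^ 2 + v2 θstar) * √(σn ^ 2 + v12 θ))) ^ 2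
        = τ2 θ / (σn ^ 2 + v12 θ) := by
      rw [div_pow, mul_pow, sq_sqrt hw2.le, sq_sqrt hS2.le, neg_sq, hτ2]
      field_simp
    have hc : ∀ z : ℝ, (ε - m1 θ (m θstar + √(σn ^ 2 + v2 θstar) * z)) / √(σn ^ 2 + v12 θ)
        = (ε - m θ) / √(σn ^ 2 + v12 θ)
          + -covf θ / (√(σn ^ 2 + v2 θstar) * √(σn ^ 2 + v12 θ)) * z := fun z => by
      have h1 : √(σn ^ 2 + v2 θstar) ^ 2 = σn ^ 2 + v2 θstar := sq_sqrt hw2.le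
      have hS := sqrt_pos.2 hS2
      rw [hm1, ← h1]
      field_simp
      rw [sqrt_sq hw.le]
      ring
    have hInt : ∀ μ q r : ℝ, Integrable (fun z => 2 * OwenT (μ + q * z) r) (gaussianReal 0 1) :=
      fun μ q r => (Integrable.of_bound (C := |r|)
        (continuous_OwenT.comp (f := fun z : ℝ => (μ + q * z, r))
          (by fun_prop)).aestronglyMeasurable
        (ae_of_all _ fun z => abs_OwenT_le _ _)).const_mul 2
    simp_rw [hc]
    rw [integral_const_mul, integral_sub (hInt _ _ _) (hInt _ _ _), integral_const_mul,
      integral_const_mul, integral_OwenT_gaussianReal, integral_OwenT_gaussianReal, hq2]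
    have ha : (ε - m θ) / √(σn ^ 2 + v12 θ) / √(1 + τ2 θ / (σn ^ 2 + v12 θ))
        = (ε - m θ) / √(σn ^ 2 + v2 θ) := by
      rw [div_div, ← sqrt_mul hS2.le, hv2']
      congr 2
      field_simp
      ring
    have hr1 : 1 / √(1 + τ2 θ / (σn ^ 2 + v12 θ) + τ2 θ / (σn ^ 2 + v12 θ) * 1 ^ 2)
        = √((σn ^ 2 + v2 θ - τ2 θ) / (σn ^ 2 + v2 θ + τ2 θ)) := by
      have h1 : 1 + τ2 θ / (σn ^ 2 + v12 θ) + τ2 θ / (σn ^ 2 + v12 θ) * 1 ^ 2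
          = (σn ^ 2 + (v12 θ + τ2 θ) + τ2 θ) / (σn ^ 2 + v12 θ) := by
        field_simp
        ring
      rw [one_div, ← sqrt_inv, hv2', h1, inv_div]
      congr 2
      ring
    have hr2 : σn / √(σn ^ 2 + 2 * v12 θ) / √(1 + τ2 θ / (σn ^ 2 + v12 θ)
          + τ2 θ / (σn ^ 2 + v12 θ) * (σn / √(σn ^ 2 + 2 * v12 θ)) ^ 2)
        = σn / √(σn ^ 2 + 2 * v2 θ) := by
      rw [div_div, ← sqrt_mul hR.le, div_pow, sq_sqrt hR.le, hv2']
      congr 2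
      field_simp
      ring
    rw [ha, hr1, hr2]
    ring
  · have hgint : Integrable (fun q : (Fin p → ℝ) × ℝ => 4 * C * prior q.1)
        (volume.prod (gaussianReal 0 1)) :=
      ((integrable_of_integral_eq_one hπint).comp_fst _).const_mul (4 * C)
    refine (integrable_swap_iff.1 (hgint.mono' (Measurable.aestronglyMeasurable ?_)
      (ae_of_all _ ?_)))
    · have hT : Measurable fun q : ℝ × ℝ => OwenT q.1 q.2 := continuous_OwenT.measurable
      have hcm : Measurable fun q : (Fin p → ℝ) × ℝ =>
          (ε - m1 q.1 (m θstar + √(σn ^ 2 + v2 θstar) * q.2)) / √(σn ^ 2 + v12 q.1) :=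
        (measurable_const.sub hm1meas).div (by fun_prop)
      have hrm : Measurable fun q : (Fin p → ℝ) × ℝ => σn / √(σn ^ 2 + 2 * v12 q.1) := by
        fun_prop
      exact ((hπmeas.comp measurable_fst).pow_const 2).mul
        (((hT.comp (hcm.prodMk measurable_const)).const_mul 2).sub
          ((hT.comp (hcm.prodMk hrm)).const_mul 2))
    · rintro ⟨θ, z⟩
      have hr : |σn / √(σn ^ 2 + 2 * v12 θ)| ≤ 1 := by
        rw [abs_of_nonneg (by positivity)]
        refine div_le_one_of_le₀ (le_sqrt_of_sq_le ?_) (sqrt_nonneg _)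
        linarith [hv12nn θ]
      simp only [Function.comp, Function.uncurry, Prod.swap]
      generalize (ε - m1 θ (m θstar + √(σn ^ 2 + v2 θstar) * z)) / √(σn ^ 2 + v12 θ) = c
      have h1 := abs_le.1 (abs_OwenT_le c 1)
      have h2 := abs_le.1 ((abs_OwenT_le c _).trans hr)
      rw [abs_one] at h1
      have h3 : |2 * OwenT c 1 - 2 * OwenT c (σn / √(σn ^ 2 + 2 * v12 θ))| ≤ 4 :=
        abs_le.2 ⟨by linarith [h1.1, h2.2], by linarith [h1.2, h2.1]⟩
      rw [norm_mul, norm_of_nonneg (sq_nonneg _), norm_eq_abs]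
      have h4 : prior θ ^ 2 ≤ C * prior θ := by
        rw [sq]
        exact mul_le_mul_of_nonneg_right (hπbdd θ) (hπnn θ)
      nlinarith [mul_le_mul h4 h3 (abs_nonneg _) ((sq_nonneg _).trans h4)]
end
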